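/- Let ξ ∈ E and let (x_i)_{i∈ℕ} be an 𝒜-2-frame associated to ξ with bounds 0 < A ≤ B. Let x ∈ E and suppose the series Σ_i ⟨x,x_i|ξ⟩•x_i converges in the norm of E to S_ξx ∈ E. Then the 𝒜-2-frame operator is bounded with respect to the 𝒜-2-norm: ‖⟨S_ξx, S_ξx | ξ⟩‖ ≤ B²·‖⟨x,x|ξ⟩‖, i.e. p(S_ξx, ξ) ≤ B·p(x,ξ). -/

import Mathlib

open WeakDual Filter
open scoped ComplexOrder

theorem CommCStarAlgebra.norm_le_of_forall_characterSpace {𝒜 : Type*} [CommCStarAlgebra 𝒜]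
    {a : 𝒜} {C : ℝ} (hC : 0 ≤ C) (h : ∀ φ : characterSpace ℂ 𝒜, ‖φ a‖ ≤ C) : ‖a‖ ≤ C := by
  rw [← (gelfandTransform_isometry 𝒜).norm_map_of_map_zero (map_zero _) a]
  exact (ContinuousMap.norm_le _ hC).2 h

theorem norm_le_sqrt_mul_sqrt_of_hasSum_mul {ι : Type*} {a b : ι → ℂ} {z : ℂ} {s t : ℝ}
    (hz : HasSum (fun i => a i * b i) z) (ha : HasSum (fun i => ‖a i‖ ^ 2) s)
    (hb : HasSum (fun i => ‖b i‖ ^ 2) t) : ‖z‖ ≤ √s * √t := by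
  refine le_of_tendsto hz.norm (Eventually.of_forall fun F => ?_)
  calc ‖∑ i ∈ F, a i * b i‖ ≤ ∑ i ∈ F, ‖a i‖ * ‖b i‖ := by
        simpa only [norm_mul] using norm_sum_le F fun i => a i * b i
    _ ≤ √(∑ i ∈ F, ‖a i‖ ^ 2) * √(∑ i ∈ F, ‖b i‖ ^ 2) :=
        Real.sum_mul_le_sqrt_mul_sqrt F _ _
    _ ≤ √s * √t := by
        gcongr
        · exact sum_le_hasSum F (fun i _ => by positivity) ha
        · exact sum_le_hasSum F (fun i _ => by positivity) hb

/-- A character turns an `𝒜`-valued frame inequality into a scalar one. -/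
theorem WeakDual.CharacterSpace.exists_hasSum_norm_sq_le {𝒜 ι : Type*} [CommCStarAlgebra 𝒜]
    [PartialOrder 𝒜] [StarOrderedRing 𝒜] (φ : characterSpace ℂ 𝒜) {c : ι → 𝒜} {q s : 𝒜} {B : ℝ}
    (hs : HasSum (fun i => c i * star (c i)) s) (hle : s ≤ B • q) (hB : 0 < B) :
    ∃ t : ℝ, HasSum (fun i => ‖φ (c i)‖ ^ 2) t ∧ t ≤ B * ‖φ q‖ := by
  have h₁ : HasSum (fun i => ((‖φ (c i)‖ ^ 2 : ℝ) : ℂ)) (φ s) := by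
    have := hs.map φ (map_continuous φ)
    convert this using 2 with i
    simp [map_star, Complex.mul_conj']
  have h₂ : φ s ≤ B * φ q := by
    have := OrderHomClass.mono φ hle
    rwa [← Complex.coe_smul, map_smul, smul_eq_mul] at this
  refine ⟨(φ s).re, Complex.hasSum_re h₁, ?_⟩
  calc (φ s).re ≤ (B * φ q).re := (Complex.le_def.1 h₂).1
    _ ≤ ‖B * φ q‖ := Complex.re_le_norm _
    _ = B * ‖φ q‖ := by rw [norm_mul, Complex.norm_of_nonneg hB.le]

/-- The inner product of a Hilbert module is continuous in its second variable. -/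
theorem continuous_hilbertModule_inner_right {𝒜 E : Type*} [CommCStarAlgebra 𝒜] [PartialOrder 𝒜]
    [StarOrderedRing 𝒜] [NormedAddCommGroup E] [Module 𝒜 E] {ip : E → E → 𝒜}
    (ip_add_right : ∀ x y z : E, ip x (y + z) = ip x y + ip x z)
    (ip_smul_right : ∀ (a : 𝒜) (x y : E), ip x (a • y) = a * ip x y)
    (ip_conj : ∀ x y : E, star (ip x y) = ip y x)
    (ip_nonneg : ∀ x : E, 0 ≤ ip x x)
    (ip_definite : ∀ x : E, ip x x = 0 → x = 0)
    (ip_norm : ∀ x : E, ‖x‖ = √‖ip x x‖) (y : E) : Continuous (ip y) := by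
  let : Module ℂ E := Module.compHom E (algebraMap ℂ 𝒜)
  let : CStarModule 𝒜 E :=
    { inner := ip
      inner_add_right := ip_add_right _ _ _
      inner_self_nonneg := ip_nonneg _
      inner_self := fun {x} => ⟨ip_definite x, by
        rintro rfl
        simpa using ip_smul_right 0 0 0⟩
      inner_op_smul_right := ip_smul_right _ _ _
      inner_smul_right_complex := fun {z x y} => by
        rw [Algebra.smul_def]
        exact ip_smul_right (algebraMap ℂ 𝒜 z) x y
      star_inner := ip_conj
      norm_eq_sqrt_norm_inner_self := ip_norm }
  exact AddMonoidHomClass.continuous_of_bound (AddMonoidHom.mk' (ip y) (ip_add_right y)) ‖y‖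
    fun z => CStarModule.norm_inner_le (A := 𝒜) E

/-- If `w = Σ c i • f i`, where `c i` are the frame coefficients of `x`, then the frame upper bound
at `x` and at `w` controls the 2-inner product of `w` with itself. -/
theorem norm_twoInner_self_le_of_hasSum {𝒜 E ι : Type*} [CommCStarAlgebra 𝒜] [PartialOrder 𝒜]
    [StarOrderedRing 𝒜] [AddCommGroup E] [TopologicalSpace E] [Module 𝒜 E] {ip : E → E → 𝒜}
    (ip_add_right : ∀ x y z : E, ip x (y + z) = ip x y + ip x z)
    (ip_smul_right : ∀ (a : 𝒜) (x y : E), ip x (a • y) = a * ip x y)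
    (ip_conj : ∀ x y : E, star (ip x y) = ip y x)
    (ip_continuous : ∀ y, Continuous (ip y))
    {ξ : E} {f : ι → E} {B : ℝ} (hB : 0 < B)
    (hframe : ∀ x : E, ∃ s : 𝒜,
      HasSum (fun i =>
        (ip x (f i) * ip ξ ξ - ip x ξ * ip ξ (f i)) *
          (ip (f i) x * ip ξ ξ - ip (f i) ξ * ip ξ x)) s ∧
      s ≤ B • (ip x x * ip ξ ξ - ip x ξ * ip ξ x))
    {x w : E} (hw : HasSum (fun i => (ip x (f i) * ip ξ ξ - ip x ξ * ip ξ (f i)) • f i) w) :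
    ‖ip w w * ip ξ ξ - ip w ξ * ip ξ w‖ ≤ B ^ 2 * ‖ip x x * ip ξ ξ - ip x ξ * ip ξ x‖ := by
  set T : E → E → 𝒜 := fun u v => ip u v * ip ξ ξ - ip u ξ * ip ξ v with hT
  have T_conj (u v : E) : star (T u v) = T v u := by
    simp only [hT, star_sub, star_mul, ip_conj]
    ring
  have ip_hasSum (y : E) : HasSum (fun i => T x (f i) * ip y (f i)) (ip y w) := by
    simpa [Function.comp_def, ip_smul_right] using
      hw.map (AddMonoidHom.mk' (ip y) (ip_add_right y)) (ip_continuous y)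
  have T_hasSum : HasSum (fun i => T x (f i) * T w (f i)) (T w w) := by
    have h := ((ip_hasSum w).mul_right (ip ξ ξ)).sub ((ip_hasSum ξ).mul_left (ip w ξ))
    refine (funext fun i => ?_ : (fun i => T x (f i) * T w (f i)) = _) ▸ h
    simp only [hT]
    ring
  refine CommCStarAlgebra.norm_le_of_forall_characterSpace (by positivity) fun φ => ?_
  have bound (u : E) : ∃ t : ℝ, HasSum (fun i => ‖φ (T u (f i))‖ ^ 2) t ∧ t ≤ B * ‖φ (T u u)‖ := by
    obtain ⟨s, hs, hle⟩ := hframe u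
    refine CharacterSpace.exists_hasSum_norm_sq_le φ (s := s) ?_ hle hB
    simpa only [T_conj] using hs
  obtain ⟨s, hs, hsle⟩ := bound x
  obtain ⟨t, ht, htle⟩ := bound w
  have hφ : HasSum (fun i => φ (T x (f i)) * φ (T w (f i))) (φ (T w w)) := by
    simpa only [Function.comp_def, map_mul] using T_hasSum.map φ (map_continuous φ)
  have key : ‖φ (T w w)‖ ^ 2 ≤ B ^ 2 * ‖φ (T x x)‖ * ‖φ (T w w)‖ := by
    have hs₀ : 0 ≤ s := hs.nonneg fun i => by positivity
    have ht₀ : 0 ≤ t := ht.nonneg fun i => by positivity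
    calc ‖φ (T w w)‖ ^ 2 ≤ (√s * √t) ^ 2 := by
          gcongr
          exact norm_le_sqrt_mul_sqrt_of_hasSum_mul hφ hs ht
      _ = s * t := by rw [mul_pow, Real.sq_sqrt hs₀, Real.sq_sqrt ht₀]
      _ ≤ (B * ‖φ (T x x)‖) * (B * ‖φ (T w w)‖) := by gcongr
      _ = B ^ 2 * ‖φ (T x x)‖ * ‖φ (T w w)‖ := by ring
  have hφx : ‖φ (T x x)‖ ≤ ‖T x x‖ := by
    rw [← (gelfandTransform_isometry 𝒜).norm_map_of_map_zero (map_zero _) (T x x)]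
    exact (gelfandTransform ℂ 𝒜 (T x x)).norm_coe_le_norm φ
  calc ‖φ (T w w)‖ ≤ B ^ 2 * ‖φ (T x x)‖ := by
        rcases (norm_nonneg (φ (T w w))).eq_or_lt with h | h
        · rw [← h]
          positivity
        · exact le_of_mul_le_mul_right (by rwa [sq] at key) h
    _ ≤ B ^ 2 * ‖T x x‖ := by gcongr


/- Setting: 𝒜 a commutative unital C*-algebra, E a Hilbert 𝒜-module with
𝒜-valued inner product `ip`, which is 𝒜-linear in the second variable,
conjugate-symmetric, positive and definite, with compatible norm.
The standard 𝒜-2-inner product is ⟨x,y|z⟩ = ip x y * ip z z - ip x z * ip z y. -/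
theorem stmt_11
    {𝒜 : Type*} [NormedCommRing 𝒜] [StarRing 𝒜] [CStarRing 𝒜]
    [NormedAlgebra ℂ 𝒜] [StarModule ℂ 𝒜] [PartialOrder 𝒜] [StarOrderedRing 𝒜]
    [CompleteSpace 𝒜]
    {E : Type*} [NormedAddCommGroup E] [Module 𝒜 E] [CompleteSpace E]
    (ip : E → E → 𝒜)
    (ip_add_right : ∀ x y z : E, ip x (y + z) = ip x y + ip x z)
    (ip_smul_right : ∀ (a : 𝒜) (x y : E), ip x (a • y) = a * ip x y)
    (ip_conj : ∀ x y : E, star (ip x y) = ip y x)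
    (ip_smul_left : ∀ (a : 𝒜) (x y : E), ip (a • x) y = star a * ip x y)
    (ip_nonneg : ∀ x : E, 0 ≤ ip x x)
    (ip_definite : ∀ x : E, ip x x = 0 → x = 0)
    (ip_norm : ∀ x : E, ‖x‖ = Real.sqrt ‖ip x x‖)
    (ξ : E) (f : ℕ → E) (A B : ℝ) (hA : 0 < A) (hAB : A ≤ B)
    (hframe : ∀ x : E, ∃ s : 𝒜,
      HasSum (fun i =>
        (ip x (f i) * ip ξ ξ - ip x ξ * ip ξ (f i)) *
          (ip (f i) x * ip ξ ξ - ip (f i) ξ * ip ξ x)) s ∧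
      A • (ip x x * ip ξ ξ - ip x ξ * ip ξ x) ≤ s ∧
      s ≤ B • (ip x x * ip ξ ξ - ip x ξ * ip ξ x))
    (x Sx : E)
    (hS : HasSum (fun i => (ip x (f i) * ip ξ ξ - ip x ξ * ip ξ (f i)) • f i) Sx) :
    ‖ip Sx Sx * ip ξ ξ - ip Sx ξ * ip ξ Sx‖ ≤ B ^ 2 * ‖ip x x * ip ξ ξ - ip x ξ * ip ξ x‖ ∧
    Real.sqrt ‖ip Sx Sx * ip ξ ξ - ip Sx ξ * ip ξ Sx‖ ≤
      B * Real.sqrt ‖ip x x * ip ξ ξ - ip x ξ * ip ξ x‖ := by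
  have hB : 0 < B := hA.trans_le hAB
  let : CommCStarAlgebra 𝒜 := {}
  have h : ‖ip Sx Sx * ip ξ ξ - ip Sx ξ * ip ξ Sx‖ ≤
      B ^ 2 * ‖ip x x * ip ξ ξ - ip x ξ * ip ξ x‖ :=
    norm_twoInner_self_le_of_hasSum ip_add_right ip_smul_right ip_conj
      (continuous_hilbertModule_inner_right ip_add_right ip_smul_right ip_conj ip_nonneg
        ip_definite ip_norm)
      hB (fun y => (hframe y).imp fun _ hs => ⟨hs.1, hs.2.2⟩) hS
  refine ⟨h, (Real.sqrt_le_sqrt h).trans_eq ?_⟩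
  rw [Real.sqrt_mul (sq_nonneg B), Real.sqrt_sq hB.le]
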